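/- arXiv:2502.01363 — 2 statements merged into one kernel-verified Lean document; each statement's English description precedes it below -/
import Mathlib

section
/- For every μ ∈ ℝ, every n ∈ ℕ₀ and t > 0, the function p̂^μ(n,t) satisfies d²/dt² p̂^μ(n,t) − 2μ d/dt p̂^μ(n,t) = 2(Λ p̂^μ(n,t) − ∑_{j=1}^{min(n,k)} λ_j p̂^μ(n−j,t)). -/
noncomputable section
open MeasureTheory Real Finset

/-- The set Ω(k,n) of k-tuples (x₁,…,x_k) of nonnegative integers with
x₁ + 2x₂ + ⋯ + k x_k = n. -/
def Omega (k n : ℕ) : Finset (Fin k → ℕ) :=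
  (Fintype.piFinset fun _ : Fin k => Finset.range (n + 1)).filter
    (fun x => ∑ j, (j.val + 1) * x j = n)

/-- The state probabilities of the generalized counting process. -/
def gcp (k : ℕ) (l : Fin k → ℝ) (n : ℕ) (t : ℝ) : ℝ :=
  ∑ x ∈ Omega k n, ∏ j, ((l j * t) ^ (x j) / (Nat.factorial (x j) : ℝ) *
    Real.exp (-(l j * t)))

/-- Density of the first-passage time through level t of a Brownian motion with drift μ. -/
def fptDrift (μ s t : ℝ) : ℝ :=
  t * Real.exp (-(t - μ * s) ^ 2 / (2 * s)) / Real.sqrt (2 * Real.pi * s ^ 3)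

/-- State probabilities of the GCP at the drifted Brownian first-passage time. -/
def phatDrift (k : ℕ) (l : Fin k → ℝ) (μ : ℝ) (n : ℕ) (t : ℝ) : ℝ :=
  ∫ s in Set.Ioi (0 : ℝ), gcp k l n s * fptDrift μ s t


lemma mem_Omega_iff (k n : ℕ) (x : Fin k → ℕ) :
    x ∈ Omega k n ↔ ∑ j, (j.val + 1) * x j = n := by
  unfold Omega
  rw [Finset.mem_filter, Fintype.mem_piFinset]
  constructor
  · exact fun h => h.2
  · intro h
    refine ⟨fun j => ?_, h⟩
    rw [Finset.mem_range]
    have h1 : (j.val + 1) * x j ≤ ∑ j, (j.val + 1) * x j :=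
      Finset.single_le_sum (f := fun j : Fin k => (j.val + 1) * x j)
        (fun _ _ => Nat.zero_le _) (Finset.mem_univ j)
    nlinarith [Nat.zero_le (j.val * x j)]

/-- one factor -/
def phiF (l : ℝ) (n : ℕ) (s : ℝ) : ℝ := (l * s) ^ n / (Nat.factorial n : ℝ) * Real.exp (-(l * s))

lemma gcp_eq (k : ℕ) (l : Fin k → ℝ) (n : ℕ) (s : ℝ) :
    gcp k l n s = ∑ x ∈ Omega k n, ∏ j, phiF (l j) (x j) s := rfl

lemma phiF_deriv (l : ℝ) (n : ℕ) (s : ℝ) :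
    HasDerivAt (phiF l n)
      ((if 1 ≤ n then l * phiF l (n - 1) s else 0) - l * phiF l n s) s := by
  have h0 : HasDerivAt (fun s : ℝ => l * s) l s := by
    simpa using (hasDerivAt_id s).const_mul l
  have h1 := ((h0.pow n).div_const (Nat.factorial n : ℝ)).mul (h0.neg.exp)
  refine h1.congr_deriv ?_
  unfold phiF
  rcases n with _ | n
  · simp
    ring
  · have : (Nat.factorial n : ℝ) ≠ 0 := by positivity
    have h3 : (n + 1 : ℝ) ≠ 0 := by positivity
    simp [Nat.factorial_succ]
    field_simp
    ring

lemma prod_deriv (k : ℕ) (l : Fin k → ℝ) (x : Fin k → ℕ) (s : ℝ) :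
    HasDerivAt (fun s => ∏ j, phiF (l j) (x j) s)
      ((∑ i, if 1 ≤ x i then l i * ∏ j, phiF (l j) (Function.update x i (x i - 1) j) s else 0)
        - (∑ j, l j) * ∏ j, phiF (l j) (x j) s) s := by
  have h := HasDerivAt.fun_finsetProd (u := Finset.univ) (x := s)
    (f := fun (j : Fin k) s => phiF (l j) (x j) s) (fun i _ => phiF_deriv (l i) (x i) s)
  refine h.congr_deriv ?_
  rw [Finset.sum_mul, ← Finset.sum_sub_distrib]
  refine Finset.sum_congr rfl fun i _ => ?_
  rw [← Finset.mul_prod_erase Finset.univ (fun j => phiF (l j) (x j) s) (Finset.mem_univ i),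
    ← Finset.mul_prod_erase Finset.univ
      (fun j => phiF (l j) (Function.update x i (x i - 1) j) s) (Finset.mem_univ i)]
  have : ∏ j ∈ Finset.univ.erase i, phiF (l j) (Function.update x i (x i - 1) j) s
      = ∏ j ∈ Finset.univ.erase i, phiF (l j) (x j) s := by
    refine Finset.prod_congr rfl fun j hj => ?_
    rw [Function.update_of_ne (Finset.ne_of_mem_erase hj)]
  rw [this]
  simp only [Function.update_self, smul_eq_mul]
  split_ifs <;> ring

lemma sum_update (k : ℕ) (x : Fin k → ℕ) (i : Fin k) (m : ℕ) :
    (∑ j, (j.val + 1) * Function.update x i m j) + (i.val + 1) * x i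
      = (∑ j, (j.val + 1) * x j) + (i.val + 1) * m := by
  rw [← Finset.add_sum_erase Finset.univ (fun j : Fin k => (j.val + 1) * x j) (Finset.mem_univ i),
    ← Finset.add_sum_erase Finset.univ
      (fun j : Fin k => (j.val + 1) * Function.update x i m j) (Finset.mem_univ i)]
  have : ∑ j ∈ Finset.univ.erase i, (j.val + 1) * Function.update x i m j
      = ∑ j ∈ Finset.univ.erase i, (j.val + 1) * x j := by
    refine Finset.sum_congr rfl fun j hj => ?_
    rw [Function.update_of_ne (Finset.ne_of_mem_erase hj)]
  rw [this]
  simp only [Function.update_self]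
  ring

lemma gcp_deriv (k : ℕ) (l : Fin k → ℝ) (n : ℕ) (s : ℝ) :
    HasDerivAt (gcp k l n)
      ((∑ j : Fin k, if j.val + 1 ≤ n then l j * gcp k l (n - (j.val + 1)) s else 0)
        - (∑ j, l j) * gcp k l n s) s := by
  have h := HasDerivAt.fun_sum (u := Omega k n) (x := s) (fun x _ => prod_deriv k l x s)
  refine h.congr_deriv ?_
  rw [Finset.sum_sub_distrib, ← Finset.mul_sum, ← gcp_eq, Finset.sum_comm]
  congr 1
  refine Finset.sum_congr rfl fun i _ => ?_
  rw [← Finset.sum_filter]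
  split_ifs with hi
  · rw [gcp_eq, Finset.mul_sum]
    refine Finset.sum_nbij' (fun x => Function.update x i (x i - 1))
      (fun y => Function.update y i (y i + 1)) ?_ ?_ ?_ ?_ ?_
    · intro x hx
      rw [Finset.mem_filter, mem_Omega_iff] at hx
      rw [mem_Omega_iff]
      have := sum_update k x i (x i - 1)
      obtain ⟨m, hm⟩ := Nat.exists_eq_add_of_le' hx.2
      rw [hx.1, hm] at this
      rw [hm]
      simp only [Nat.add_sub_cancel] at *
      have e : (i.val + 1) * (m + 1) = (i.val + 1) * m + (i.val + 1) := by ring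
      omega
    · intro y hy
      rw [mem_Omega_iff] at hy
      rw [Finset.mem_filter, mem_Omega_iff]
      have := sum_update k y i (y i + 1)
      have e : (i.val + 1) * (y i + 1) = (i.val + 1) * y i + (i.val + 1) := by ring
      refine ⟨by omega, by simp⟩
    · intro x hx
      rw [Finset.mem_filter] at hx
      have : x i - 1 + 1 = x i := by omega
      simp [this]
    · intro y hy
      simp
    · intro x hx
      rfl
  · apply Finset.sum_eq_zero
    intro x hx
    exfalso
    rw [Finset.mem_filter, mem_Omega_iff] at hx
    have h1 : (i.val + 1) * x i ≤ ∑ j, (j.val + 1) * x j :=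
      Finset.single_le_sum (f := fun j : Fin k => (j.val + 1) * x j)
        (fun _ _ => Nat.zero_le _) (Finset.mem_univ i)
    nlinarith [hx.1, hx.2]

lemma gcp_bound' (k : ℕ) (l : Fin k → ℝ) (hl : ∀ j, 0 < l j) (n : ℕ) :
    ∃ C, ∀ s > 0, |gcp k l n s| ≤ C * Real.exp (-((∑ j, l j) / 2) * s) := by
  refine ⟨∑ x ∈ Omega k n, ∏ j, (2 : ℝ) ^ x j, fun s hs => ?_⟩
  rw [gcp_eq, Finset.sum_mul]
  refine (Finset.abs_sum_le_sum_abs _ _).trans (Finset.sum_le_sum fun x _ => ?_)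
  have e : Real.exp (-((∑ j, l j) / 2) * s) = ∏ j, Real.exp (-(l j * s / 2)) := by
    rw [← Real.exp_sum]
    congr 1
    rw [Finset.sum_neg_distrib, ← Finset.sum_div, ← Finset.sum_mul]
    ring
  rw [e, ← Finset.prod_mul_distrib, Finset.abs_prod]
  refine Finset.prod_le_prod (fun _ _ => abs_nonneg _) fun j _ => ?_
  have hj := hl j
  unfold phiF
  rw [abs_of_nonneg (by positivity)]
  have h1 := Real.pow_div_factorial_le_exp (l j * s / 2) (by positivity) (x j)
  have h2 : Real.exp (-(l j * s)) = Real.exp (-(l j * s / 2)) * Real.exp (-(l j * s / 2)) := by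
    rw [← Real.exp_add]; ring_nf
  have h3 : (l j * s) ^ x j = 2 ^ x j * (l j * s / 2) ^ x j := by
    rw [← mul_pow]; ring_nf
  have h4 : Real.exp (l j * s / 2) * Real.exp (-(l j * s / 2)) = 1 := by
    rw [← Real.exp_add]; simp
  calc _ = 2 ^ x j * Real.exp (-(l j * s / 2)) *
        ((l j * s / 2) ^ x j / (Nat.factorial (x j) : ℝ) * Real.exp (-(l j * s / 2))) := by
        rw [h2, h3]; ring
    _ ≤ 2 ^ x j * Real.exp (-(l j * s / 2)) *
        (Real.exp (l j * s / 2) * Real.exp (-(l j * s / 2))) := by gcongr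
    _ = _ := by rw [h4, mul_one]

lemma gcp_bound (k : ℕ) (hk : 1 ≤ k) (l : Fin k → ℝ) (hl : ∀ j, 0 < l j) (n : ℕ) :
    ∃ C, ∃ ε > 0, ∀ s > 0, |gcp k l n s| ≤ C * Real.exp (-ε * s) := by
  have hL : 0 < ∑ j, l j := Finset.sum_pos (fun j _ => hl j) ⟨⟨0, hk⟩, Finset.mem_univ _⟩
  obtain ⟨C, hC⟩ := gcp_bound' k l hl n
  exact ⟨C, (∑ j, l j) / 2, by positivity, hC⟩

/-- time kernel -/
def kerK (μ : ℝ) (m : ℕ) (t s : ℝ) : ℝ :=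
  Real.exp (-(μ ^ 2 * s / 2)) / Real.sqrt (2 * Real.pi * s ^ 3) * s⁻¹ ^ m *
    Real.exp (-(t ^ 2 / (2 * s)))

lemma kerK_meas (μ : ℝ) (m : ℕ) (t : ℝ) : Measurable (kerK μ m t) := by
  unfold kerK
  fun_prop

lemma kerK_nonneg (μ : ℝ) (m : ℕ) (t s : ℝ) (hs : 0 < s) : 0 ≤ kerK μ m t s := by
  unfold kerK
  positivity

lemma kerK_bound (μ : ℝ) (m : ℕ) (a : ℝ) (ha : 0 < a) :
    ∃ C, ∀ s > 0, ∀ t ≥ a, |kerK μ m t s| ≤ C := by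
  set c := a ^ 2 / 2 with hc
  have hc0 : 0 < c := by positivity
  have key : ∀ (N : ℕ) (y : ℝ), 0 < y → y ^ N * Real.exp (-(c * y)) ≤ Nat.factorial N / c ^ N := by
    intro N y hy
    have h1 := Real.pow_div_factorial_le_exp (c * y) (by positivity) N
    rw [div_le_iff₀ (by positivity), mul_pow] at h1
    rw [le_div_iff₀ (by positivity), Real.exp_neg]
    have h2 := Real.exp_pos (c * y)
    field_simp
    linarith
  refine ⟨Nat.factorial m / c ^ m + Nat.factorial (m + 3) / c ^ (m + 3), fun s hs t hat => ?_⟩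
  rw [abs_of_nonneg (kerK_nonneg μ m t s hs)]
  unfold kerK
  have e1 : Real.exp (-(μ ^ 2 * s / 2)) ≤ 1 := by
    rw [Real.exp_le_one_iff]
    have : 0 ≤ μ ^ 2 * s / 2 := by positivity
    linarith
  have e2 : Real.exp (-(t ^ 2 / (2 * s))) ≤ Real.exp (-(c * s⁻¹)) := by
    apply Real.exp_le_exp.2
    have : c * s⁻¹ = a ^ 2 / (2 * s) := by rw [hc]; field_simp
    rw [this]
    have : a ^ 2 / (2 * s) ≤ t ^ 2 / (2 * s) := by gcongr
    linarith
  have e3 : (Real.sqrt (2 * Real.pi * s ^ 3))⁻¹ ≤ 1 + s⁻¹ ^ 3 := by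
    rw [← Real.sqrt_inv]
    have hy : 0 < s⁻¹ ^ 3 := by positivity
    rw [Real.sqrt_le_iff]
    refine ⟨by positivity, ?_⟩
    have : (2 * Real.pi * s ^ 3)⁻¹ ≤ (s ^ 3)⁻¹ := by
      apply inv_anti₀ (by positivity)
      have := Real.pi_gt_three
      have h3 : 0 < s ^ 3 := by positivity
      nlinarith
    rw [← inv_pow] at this
    nlinarith
  calc _ = Real.exp (-(μ ^ 2 * s / 2)) * (Real.sqrt (2 * Real.pi * s ^ 3))⁻¹ * s⁻¹ ^ m *
        Real.exp (-(t ^ 2 / (2 * s))) := by rw [div_eq_mul_inv]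
    _ ≤ 1 * (1 + s⁻¹ ^ 3) * s⁻¹ ^ m * Real.exp (-(c * s⁻¹)) := by gcongr
    _ = s⁻¹ ^ m * Real.exp (-(c * s⁻¹)) + s⁻¹ ^ (m + 3) * Real.exp (-(c * s⁻¹)) := by ring
    _ ≤ _ := add_le_add (key _ _ (by positivity)) (key _ _ (by positivity))

lemma kerK_deriv_t (μ : ℝ) (m : ℕ) (t s : ℝ) (hs : 0 < s) :
    HasDerivAt (fun t => kerK μ m t s) (-t * kerK μ (m + 1) t s) t := by
  unfold kerK
  have h1 : HasDerivAt (fun t : ℝ => -(t ^ 2 / (2 * s))) (-(2 * t / (2 * s))) t := by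
    simpa using! (((hasDerivAt_id t).pow 2).div_const (2 * s)).neg
  refine (h1.exp.const_mul _).congr_deriv ?_
  have : -(2 * t / (2 * s)) = -t * s⁻¹ := by field_simp
  rw [this]
  ring

lemma kerK_deriv_s (μ : ℝ) (t s : ℝ) (hs : 0 < s) :
    HasDerivAt (fun s => kerK μ 0 t s)
      (-(μ ^ 2 / 2) * kerK μ 0 t s - 3 / 2 * kerK μ 1 t s + t ^ 2 / 2 * kerK μ 2 t s) s := by
  unfold kerK
  have hpos : 0 < 2 * Real.pi * s ^ 3 := by positivity
  have h1 : HasDerivAt (fun s : ℝ => -(t ^ 2 / (2 * s))) (t ^ 2 / 2 * s⁻¹ ^ 2) s := by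
    have := ((hasDerivAt_inv hs.ne').const_mul (-(t ^ 2 / 2)))
    refine (this.congr_deriv (by field_simp)).congr_of_eventuallyEq ?_
    refine Filter.Eventually.of_forall fun x => ?_
    simp only [div_eq_mul_inv, mul_inv]
    ring
  have h2 : HasDerivAt (fun s : ℝ => -(μ ^ 2 * s / 2)) (-(μ ^ 2 / 2)) s := by
    have := ((hasDerivAt_id s).const_mul (μ ^ 2)).div_const 2
    simpa using! this.neg
  have h3 : HasDerivAt (fun s : ℝ => 2 * Real.pi * s ^ 3) (2 * Real.pi * (3 * s ^ 2)) s := by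
    simpa using ((hasDerivAt_pow 3 s).const_mul (2 * Real.pi))
  have h4 := h3.sqrt hpos.ne'
  have hq : 0 < Real.sqrt (2 * Real.pi * s ^ 3) := Real.sqrt_pos.2 hpos
  have h5 := ((h2.exp.div h4 hq.ne').mul_const ((1 : ℝ))).mul h1.exp
  simp only [pow_zero]
  refine h5.congr_deriv ?_
  have hsq : Real.sqrt (2 * Real.pi * s ^ 3) ^ 2 = 2 * Real.pi * s ^ 3 := Real.sq_sqrt hpos.le
  have hp := Real.pi_pos
  simp only [Pi.div_apply]
  clear h5 h4 h3 h2 h1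
  generalize Real.sqrt (2 * Real.pi * s ^ 3) = q at *
  generalize Real.exp (-(μ ^ 2 * s / 2)) = A at *
  generalize Real.exp (-(t ^ 2 / (2 * s))) = B at *
  have h6 : 2 * Real.pi * (3 * s ^ 2) / (2 * q) = 3 / 2 * s⁻¹ * q := by
    field_simp
    rw [hsq]
  rw [h6]
  field_simp

/-- weighted kernel integral -/
def intJ (G : ℝ → ℝ) (μ : ℝ) (m : ℕ) (t : ℝ) : ℝ :=
  ∫ s in Set.Ioi (0 : ℝ), G s * kerK μ m t s

lemma dom_int {G : ℝ → ℝ} {C ε : ℝ} (hG : ∀ s > 0, |G s| ≤ C * Real.exp (-ε * s))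
    (μ : ℝ) (m : ℕ) {a : ℝ} (ha : 0 < a) :
    ∃ D, ∀ s > 0, ∀ t ≥ a, |G s * kerK μ m t s| ≤ D * Real.exp (-ε * s) := by
  obtain ⟨K, hK⟩ := kerK_bound μ m a ha
  refine ⟨C * K, fun s hs t hta => ?_⟩
  rw [abs_mul]
  calc _ ≤ (C * Real.exp (-ε * s)) * K :=
        mul_le_mul (hG s hs) (hK s hs t hta) (abs_nonneg _) ((abs_nonneg _).trans (hG s hs))
    _ = _ := by ring

lemma int_ker {G : ℝ → ℝ} (hGm : Measurable G) {C ε : ℝ} (hε : 0 < ε)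
    (hG : ∀ s > 0, |G s| ≤ C * Real.exp (-ε * s))
    (μ : ℝ) (m : ℕ) {t : ℝ} (ht : 0 < t) :
    IntegrableOn (fun s => G s * kerK μ m t s) (Set.Ioi 0) := by
  obtain ⟨D, hD⟩ := dom_int hG μ m ht
  refine Integrable.mono' ((exp_neg_integrableOn_Ioi 0 hε).const_mul D)
    (hGm.mul (kerK_meas μ m t)).aestronglyMeasurable ?_
  filter_upwards [ae_restrict_mem measurableSet_Ioi] with s hs
  exact hD s hs t le_rfl

lemma intJ_deriv {G : ℝ → ℝ} (hGm : Measurable G) {C ε : ℝ} (hε : 0 < ε)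
    (hG : ∀ s > 0, |G s| ≤ C * Real.exp (-ε * s))
    (μ : ℝ) (m : ℕ) {t : ℝ} (ht : 0 < t) :
    HasDerivAt (intJ G μ m) (-t * intJ G μ (m + 1) t) t := by
  obtain ⟨D, hD⟩ := dom_int hG μ (m + 1) (half_pos ht)
  have h := hasDerivAt_integral_of_dominated_loc_of_deriv_le (𝕜 := ℝ)
    (μ := volume.restrict (Set.Ioi (0 : ℝ)))
    (F := fun t s => G s * kerK μ m t s)
    (F' := fun t s => G s * (-t * kerK μ (m + 1) t s))
    (x₀ := t) (s := Set.Ioo (t / 2) (2 * t))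
    (bound := fun s => 2 * t * (D * Real.exp (-ε * s)))
    (Ioo_mem_nhds (by linarith) (by linarith))
    (Filter.Eventually.of_forall fun x => (hGm.mul (kerK_meas μ m x)).aestronglyMeasurable)
    (int_ker hGm hε hG μ m ht)
    (hGm.mul ((kerK_meas μ (m + 1) t).const_mul _)).aestronglyMeasurable
    (by
      filter_upwards [ae_restrict_mem measurableSet_Ioi] with s hs x hx
      have h1 := hD s hs x hx.1.le
      have h2 : G s * (-x * kerK μ (m + 1) x s) = -x * (G s * kerK μ (m + 1) x s) := by ring
      have hx0 : 0 < x := by linarith [hx.1]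
      rw [h2, Real.norm_eq_abs, abs_mul, abs_neg, abs_of_pos hx0]
      exact mul_le_mul hx.2.le h1 (abs_nonneg _) (by linarith))
    (((exp_neg_integrableOn_Ioi 0 hε).const_mul D).const_mul _)
    (by
      filter_upwards [ae_restrict_mem measurableSet_Ioi] with s hs x hx
      exact (kerK_deriv_t μ m x s hs).const_mul _)
  refine h.2.congr_deriv ?_
  unfold intJ
  rw [← integral_const_mul]
  congr 1
  ext s
  ring

lemma ibp {G G' : ℝ → ℝ} (hd : ∀ s, HasDerivAt G (G' s) s) (hG'm : Measurable G')
    {C ε : ℝ} (hε : 0 < ε) (hG : ∀ s > 0, |G s| ≤ C * Real.exp (-ε * s))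
    {C' ε' : ℝ} (hε' : 0 < ε') (hG' : ∀ s > 0, |G' s| ≤ C' * Real.exp (-ε' * s))
    (μ : ℝ) {t : ℝ} (ht : 0 < t) :
    intJ G' μ 0 t + (-(μ ^ 2 / 2) * intJ G μ 0 t - 3 / 2 * intJ G μ 1 t
      + t ^ 2 / 2 * intJ G μ 2 t) = 0 := by
  have hGm : Measurable G := (continuous_iff_continuousAt.2 fun s => (hd s).continuousAt).measurable
  have i' := int_ker hG'm hε' hG' μ 0 ht
  have i0 := int_ker hGm hε hG μ 0 ht
  have i1 := int_ker hGm hε hG μ 1 ht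
  have i2 := int_ker hGm hε hG μ 2 ht
  have iA := ((i0.const_mul (-(μ ^ 2 / 2))).sub (i1.const_mul (3 / 2)))
  have iB := iA.add (i2.const_mul (t ^ 2 / 2))
  have hz : G 0 * kerK μ 0 t 0 = 0 := by simp [kerK]
  have key := integral_Ioi_of_hasDerivAt_of_tendsto (a := (0 : ℝ)) (m := 0)
    (f := fun s => G s * kerK μ 0 t s)
    (f' := fun s => G' s * kerK μ 0 t s + (-(μ ^ 2 / 2) * (G s * kerK μ 0 t s)
      - 3 / 2 * (G s * kerK μ 1 t s) + t ^ 2 / 2 * (G s * kerK μ 2 t s)))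
    (by
      obtain ⟨D, hD⟩ := dom_int hG μ 1 ht
      unfold ContinuousWithinAt
      simp only [hz]
      apply squeeze_zero_norm' (a := fun s : ℝ => s * |D|)
      · filter_upwards [self_mem_nhdsWithin] with s hs
        rcases eq_or_lt_of_le (show (0 : ℝ) ≤ s from hs) with h0 | h0
        · subst h0
          simp [hz]
        · have h1 := hD s h0 t le_rfl
          have h2 : G s * kerK μ 0 t s = s * (G s * kerK μ 1 t s) := by
            unfold kerK
            have := h0.ne'
            field_simp
          rw [h2, Real.norm_eq_abs, abs_mul, abs_of_pos h0]
          have h3 : Real.exp (-ε * s) ≤ 1 := by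
            rw [Real.exp_le_one_iff]; nlinarith
          have h4 : D * Real.exp (-ε * s) ≤ |D| :=
            calc D * Real.exp (-ε * s) ≤ |D| * 1 :=
                mul_le_mul (le_abs_self D) h3 (Real.exp_pos _).le (abs_nonneg _)
              _ = |D| := mul_one _
          exact mul_le_mul_of_nonneg_left (h1.trans h4) h0.le
      · have : Filter.Tendsto (fun s : ℝ => s * |D|) (nhds 0) (nhds (0 * |D|)) :=
          (continuous_id.mul continuous_const).tendsto 0
        rw [zero_mul] at this
        exact this.mono_left nhdsWithin_le_nhds)
    (by
      intro s hs
      refine ((hd s).mul (kerK_deriv_s μ t s hs)).congr_deriv ?_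
      ring)
    (i'.add iB)
    (by
      obtain ⟨D, hD⟩ := dom_int hG μ 0 ht
      apply squeeze_zero_norm' (a := fun s : ℝ => D * Real.exp (-ε * s))
      · filter_upwards [Filter.eventually_gt_atTop 0] with s hs
        exact hD s hs t le_rfl
      · have h1 : Filter.Tendsto (fun s : ℝ => -ε * s) Filter.atTop Filter.atBot :=
          Filter.tendsto_id.const_mul_atTop_of_neg (by linarith)
        simpa using (Real.tendsto_exp_atBot.comp h1).const_mul D)
  have e1 := integral_add i' iB
  have e2 := integral_add iA (i2.const_mul (t ^ 2 / 2))
  have e3 := integral_sub (i0.const_mul (-(μ ^ 2 / 2))) (i1.const_mul (3 / 2))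
  simp only [integral_const_mul] at e1 e2 e3
  simp only [Pi.add_apply, Pi.sub_apply] at e1 e2 e3
  simp only [hz, sub_zero] at key
  unfold intJ
  rw [← e3, ← e2, ← e1]
  exact key

lemma phat_eq (k : ℕ) (l : Fin k → ℝ) (μ : ℝ) (n : ℕ) (t : ℝ) :
    phatDrift k l μ n t = t * Real.exp (μ * t) * intJ (gcp k l n) μ 0 t := by
  unfold phatDrift intJ
  rw [← integral_const_mul]
  refine setIntegral_congr_fun measurableSet_Ioi fun s hs => ?_
  have hs0 : s ≠ 0 := (show (0 : ℝ) < s from hs).ne'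
  have : -(t - μ * s) ^ 2 / (2 * s) = μ * t + -(μ ^ 2 * s / 2) + -(t ^ 2 / (2 * s)) := by
    field_simp
    ring
  simp only [fptDrift, kerK]
  rw [this, Real.exp_add, Real.exp_add]
  ring

lemma intJ_lin (k : ℕ) (hk : 1 ≤ k) (l : Fin k → ℝ) (hl : ∀ j, 0 < l j)
    (hm : ∀ n, Measurable (gcp k l n)) (μ : ℝ) (n : ℕ) (t : ℝ) (ht : 0 < t) :
    intJ (fun s => (∑ j : Fin k, if j.val + 1 ≤ n then l j * gcp k l (n - (j.val + 1)) s else 0)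
        - (∑ j, l j) * gcp k l n s) μ 0 t =
    (∑ j : Fin k, if j.val + 1 ≤ n then l j * intJ (gcp k l (n - (j.val + 1))) μ 0 t else 0)
        - (∑ j, l j) * intJ (gcp k l n) μ 0 t := by
  have hi : ∀ n, IntegrableOn (fun s => gcp k l n s * kerK μ 0 t s) (Set.Ioi 0) := by
    intro n
    obtain ⟨C, ε, hε, hb⟩ := gcp_bound k hk l hl n
    exact int_ker (hm n) hε hb μ 0 ht
  have hterm : ∀ j : Fin k, IntegrableOn (fun s => if j.val + 1 ≤ n then
      l j * (gcp k l (n - (j.val + 1)) s * kerK μ 0 t s) else 0) (Set.Ioi 0) := by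
    intro j
    split_ifs
    · exact (hi _).const_mul _
    · exact integrableOn_zero
  unfold intJ
  have e : ∀ s, ((∑ j : Fin k, if j.val + 1 ≤ n then l j * gcp k l (n - (j.val + 1)) s else 0)
        - (∑ j, l j) * gcp k l n s) * kerK μ 0 t s =
      (∑ j : Fin k, if j.val + 1 ≤ n then
        l j * (gcp k l (n - (j.val + 1)) s * kerK μ 0 t s) else 0)
        - (∑ j, l j) * (gcp k l n s * kerK μ 0 t s) := by
    intro s
    rw [sub_mul, Finset.sum_mul, mul_assoc]
    congr 1
    refine Finset.sum_congr rfl fun j _ => ?_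
    split_ifs <;> ring
  simp only [e]
  rw [integral_sub (integrable_finsetSum _ fun j _ => hterm j) ((hi n).const_mul _),
    integral_finsetSum _ fun j _ => hterm j, integral_const_mul]
  congr 1
  refine Finset.sum_congr rfl fun j _ => ?_
  split_ifs
  · rw [integral_const_mul]
  · simp

lemma gcp'_bound (k : ℕ) (hk : 1 ≤ k) (l : Fin k → ℝ) (hl : ∀ j, 0 < l j) (n : ℕ) :
    ∃ C, ∃ ε > 0, ∀ s > 0,
      |(∑ j : Fin k, if j.val + 1 ≤ n then l j * gcp k l (n - (j.val + 1)) s else 0)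
        - (∑ j, l j) * gcp k l n s| ≤ C * Real.exp (-ε * s) := by
  set ε := (∑ j, l j) / 2 with hε
  have hL : 0 < ∑ j, l j := Finset.sum_pos (fun j _ => hl j) ⟨⟨0, hk⟩, Finset.mem_univ _⟩
  choose C hC using gcp_bound' k l hl
  refine ⟨(∑ j : Fin k, if j.val + 1 ≤ n then l j * C (n - (j.val + 1)) else 0)
    + (∑ j, l j) * C n, ε, by positivity, fun s hs => ?_⟩
  refine (abs_sub _ _).trans ?_
  rw [add_mul, Finset.sum_mul (s := (Finset.univ : Finset (Fin k)))
    (f := fun j : Fin k => if j.val + 1 ≤ n then l j * C (n - (j.val + 1)) else 0)]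
  refine add_le_add ((Finset.abs_sum_le_sum_abs _ _).trans (Finset.sum_le_sum fun j _ => ?_)) ?_
  · split_ifs
    · rw [abs_mul, abs_of_pos (hl j), mul_assoc]
      exact mul_le_mul_of_nonneg_left (hC _ s hs) (hl j).le
    · simp
  · rw [abs_mul, abs_of_pos hL, mul_assoc]
    exact mul_le_mul_of_nonneg_left (hC _ s hs) hL.le

theorem gcp_fpt_drift_ode (k : ℕ) (hk : 1 ≤ k) (l : Fin k → ℝ) (hl : ∀ j, 0 < l j)
    (μ : ℝ) (n : ℕ) (t : ℝ) (ht : 0 < t) :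
    deriv (deriv (phatDrift k l μ n)) t - 2 * μ * deriv (phatDrift k l μ n) t =
      2 * ((∑ j, l j) * phatDrift k l μ n t -
        ∑ j : Fin k, if j.val + 1 ≤ n then l j * phatDrift k l μ (n - (j.val + 1)) t else 0) := by
  have hm : ∀ n, Measurable (gcp k l n) := fun n =>
    (continuous_iff_continuousAt.2 fun s => (gcp_deriv k l n s).continuousAt).measurable
  obtain ⟨C, ε, hε, hb⟩ := gcp_bound k hk l hl n
  obtain ⟨C', ε', hε', hb'⟩ := gcp'_bound k hk l hl n
  have hJ : ∀ m, ∀ t > 0, HasDerivAt (intJ (gcp k l n) μ m)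
      (-t * intJ (gcp k l n) μ (m + 1) t) t := fun m t ht => intJ_deriv (hm n) hε hb μ m ht
  have hE : ∀ t : ℝ, HasDerivAt (fun t => Real.exp (μ * t)) (Real.exp (μ * t) * μ) t := by
    intro t
    have : HasDerivAt (fun t : ℝ => μ * t) μ t := by
      simpa using (hasDerivAt_id t).const_mul μ
    exact this.exp
  have hP : phatDrift k l μ n = fun t => t * Real.exp (μ * t) * intJ (gcp k l n) μ 0 t :=
    funext (phat_eq k l μ n)
  have d1 : ∀ t > 0, HasDerivAt (phatDrift k l μ n)
      ((1 + μ * t) * Real.exp (μ * t) * intJ (gcp k l n) μ 0 t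
        - t ^ 2 * Real.exp (μ * t) * intJ (gcp k l n) μ 1 t) t := by
    intro t ht
    rw [hP]
    refine (((hasDerivAt_id t).mul (hE t)).mul (hJ 0 t ht)).congr_deriv ?_
    simp
    ring
  have d2 : HasDerivAt (deriv (phatDrift k l μ n))
      (Real.exp (μ * t) * ((2 * μ + μ ^ 2 * t) * intJ (gcp k l n) μ 0 t
        - (3 * t + 2 * μ * t ^ 2) * intJ (gcp k l n) μ 1 t
        + t ^ 3 * intJ (gcp k l n) μ 2 t)) t := by
    have hev : deriv (phatDrift k l μ n) =ᶠ[nhds t] fun t =>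
        (1 + μ * t) * Real.exp (μ * t) * intJ (gcp k l n) μ 0 t
        - t ^ 2 * Real.exp (μ * t) * intJ (gcp k l n) μ 1 t := by
      filter_upwards [lt_mem_nhds ht] with x hx
      exact (d1 x hx).deriv
    refine HasDerivAt.congr_of_eventuallyEq ?_ hev
    have ha : HasDerivAt (fun t : ℝ => 1 + μ * t) μ t := by
      simpa using ((hasDerivAt_id t).const_mul μ).const_add 1
    refine (((ha.mul (hE t)).mul (hJ 0 t ht)).sub
      (((hasDerivAt_pow 2 t).mul (hE t)).mul (hJ 1 t ht))).congr_deriv ?_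
    simp
    ring
  have hI := ibp (G := gcp k l n) (gcp_deriv k l n)
    ((Finset.measurable_fun_sum _ fun j _ => by
      split_ifs
      · exact (hm _).const_mul _
      · exact measurable_const).sub ((hm n).const_mul _)) hε hb hε' hb' μ ht
  rw [intJ_lin k hk l hl hm μ n t ht] at hI
  rw [d2.deriv, (d1 t ht).deriv]
  have hS : (∑ j : Fin k, if j.val + 1 ≤ n then l j * phatDrift k l μ (n - (j.val + 1)) t else 0)
      = t * Real.exp (μ * t) * (∑ j : Fin k, if j.val + 1 ≤ n then
          l j * intJ (gcp k l (n - (j.val + 1))) μ 0 t else 0) := by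
    rw [Finset.mul_sum]
    refine Finset.sum_congr rfl fun j _ => ?_
    split_ifs
    · rw [phat_eq]; ring
    · simp
  rw [hS, phat_eq]
  linear_combination (2 * t * Real.exp (μ * t)) * hI
end
end

section
/- For every μ ∈ ℝ, every n ∈ ℕ₀ and t > 0, p̂^μ(n,t) = ∑_{Ω(k,n)} (∏_{j=1}^k λ_j^{x_j}/x_j!) · (√2 t/√π) e^{μt} (t²/(2Λ + μ²))^{z_k/2 − 1/4} K_{z_k − 1/2}(t√(2Λ + μ²)), where z_k = x_1 + x_2 + ⋯ + x_k. -/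
noncomputable section
open MeasureTheory Real Finset

/-- The modified Bessel function of index α. -/
def besselK (α s : ℝ) : ℝ :=
  (1 / 2) * (s / 2) ^ α * ∫ u in Set.Ioi (0 : ℝ), Real.exp (-u - s ^ 2 / (4 * u)) * u ^ (-α - 1)

lemma aux_integrable (a c b : ℝ) (ha : -1 / 2 ≤ a) (hc : 0 < c) (hb : 0 < b) :
    IntegrableOn (fun s : ℝ => s ^ (a - 1) * Real.exp (-(c * s) - b / s)) (Set.Ioi 0) := by
  have h1 : IntegrableOn (fun s : ℝ => b⁻¹ * (s ^ a * Real.exp (-c * s ^ (1:ℝ)))) (Set.Ioi 0) :=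
    (integrableOn_rpow_mul_exp_neg_mul_rpow (p := 1) (s := a) (b := c) (by linarith)
      (by norm_num) hc).const_mul _
  refine Integrable.mono' h1 ?_ ?_
  · apply ContinuousOn.aestronglyMeasurable _ measurableSet_Ioi
    intro s hs
    have hs' : s ≠ 0 := ne_of_gt hs
    apply ContinuousAt.continuousWithinAt
    apply ContinuousAt.mul
    · exact Real.continuousAt_rpow_const _ _ (Or.inl hs')
    · fun_prop (disch := assumption)
  · refine (ae_restrict_iff' measurableSet_Ioi).2 (Filter.Eventually.of_forall fun s hs => ?_)
    have hs : 0 < s := hs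
    have h2 : Real.exp (-(b / s)) ≤ s / b := by
      rw [Real.exp_neg, ← inv_div b s]
      apply inv_anti₀ (by positivity)
      linarith [Real.add_one_le_exp (b / s)]
    rw [Real.norm_of_nonneg (by positivity), sub_eq_add_neg (-(c * s)), Real.exp_add, Real.rpow_one]
    have h3 : s ^ a = s ^ (a - 1) * s := by
      rw [Real.rpow_sub_one hs.ne']; field_simp
    have h4 : 0 ≤ s ^ (a - 1) * Real.exp (-(c * s)) := by positivity
    calc s ^ (a - 1) * (Real.exp (-(c * s)) * Real.exp (-(b / s)))
        = s ^ (a - 1) * Real.exp (-(c * s)) * Real.exp (-(b / s)) := by ring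
      _ ≤ s ^ (a - 1) * Real.exp (-(c * s)) * (s / b) := by gcongr
      _ = b⁻¹ * (s ^ a * Real.exp (-c * s)) := by rw [h3, neg_mul]; ring

lemma aux_subst (a c b : ℝ) (hb : 0 < b) :
    ∫ s in Set.Ioi (0:ℝ), s ^ (a - 1) * Real.exp (-(c * s) - b / s) =
      b ^ a * ∫ u in Set.Ioi (0:ℝ), Real.exp (-u - c * b / u) * u ^ (-a - 1) := by
  rw [← integral_comp_rpow_Ioi (fun u : ℝ => Real.exp (-u - c * b / u) * u ^ (-a - 1))
    (p := -1) (by norm_num)]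
  have h := integral_comp_mul_left_Ioi (fun x : ℝ => (|(-1:ℝ)| * x ^ ((-1:ℝ) - 1)) •
      (Real.exp (-(x ^ (-1:ℝ)) - c * b / (x ^ (-1:ℝ))) * (x ^ (-1:ℝ)) ^ (-a - 1))) 0
      (b := b⁻¹) (by positivity)
  rw [mul_zero, inv_inv, smul_eq_mul] at h
  have h' : ∀ X Y : ℝ, X = b * Y → b ^ a * Y = b ^ (a - 1) * X := by
    intro X Y hXY
    rw [hXY, Real.rpow_sub_one hb.ne']; field_simp
  rw [h' _ _ h, ← integral_const_mul]
  refine setIntegral_congr_fun measurableSet_Ioi fun s hs => ?_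
  have hs : 0 < s := hs
  have e1 : (b⁻¹ * s) ^ (-1:ℝ) = b / s := by
    rw [Real.rpow_neg_one]; field_simp
  have e2 : (b⁻¹ * s) ^ ((-1:ℝ) - 1) = (b / s) ^ (2:ℝ) := by
    rw [← e1, ← Real.rpow_mul (by positivity)]; norm_num
  have e3 : (b / s) ^ (2:ℝ) * (b / s) ^ (-a - 1) = (s / b) ^ (a - 1) := by
    rw [← Real.rpow_add (by positivity), ← inv_div s b, Real.inv_rpow (by positivity),
      ← Real.rpow_neg (by positivity)]
    congr 1; ring
  have e4 : b ^ (a - 1) * (s / b) ^ (a - 1) = s ^ (a - 1) := by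
    rw [← Real.mul_rpow hb.le (by positivity)]; congr 1; field_simp
  have e5 : -(b / s) - c * b / (b / s) = -(c * s) - b / s := by
    field_simp; ring
  simp only [smul_eq_mul, abs_neg, abs_one, one_mul]
  rw [e1, e2, e5, ← e4, ← e3]; ring

lemma aux_fpt (μ s t : ℝ) (hs : 0 < s) (L : ℝ) (z : ℕ) :
    s ^ z * Real.exp (-(L * s)) * fptDrift μ s t =
      (t * Real.exp (μ * t) / Real.sqrt (2 * Real.pi)) *
      (s ^ (((z : ℝ) - 1 / 2) - 1) *
        Real.exp (-((2 * L + μ ^ 2) / 2 * s) - (t ^ 2 / 2) / s)) := by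
  unfold fptDrift
  have e1 : Real.sqrt (2 * Real.pi * s ^ 3) = Real.sqrt (2 * Real.pi) * s ^ (3 / 2 : ℝ) := by
    rw [Real.sqrt_mul (by positivity), Real.sqrt_eq_rpow (s ^ 3), ← Real.rpow_natCast,
      ← Real.rpow_mul hs.le]
    norm_num
  have e2 : s ^ (((z : ℝ) - 1 / 2) - 1) = s ^ z / s ^ (3 / 2 : ℝ) := by
    rw [← Real.rpow_natCast, ← Real.rpow_sub hs]; congr 1; ring
  have e3 : Real.exp (-(L * s)) * Real.exp (-(t - μ * s) ^ 2 / (2 * s)) =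
      Real.exp (μ * t) * Real.exp (-((2 * L + μ ^ 2) / 2 * s) - (t ^ 2 / 2) / s) := by
    rw [← Real.exp_add, ← Real.exp_add]; congr 1; field_simp; ring
  rw [e1, e2]
  calc _ = s ^ z * t / (Real.sqrt (2 * Real.pi) * s ^ (3 / 2 : ℝ)) *
        (Real.exp (-(L * s)) * Real.exp (-(t - μ * s) ^ 2 / (2 * s))) := by ring
    _ = _ := by rw [e3]; field_simp

lemma aux_prod (k : ℕ) (l : Fin k → ℝ) (x : Fin k → ℕ) (s : ℝ) :
    (∏ j, ((l j * s) ^ (x j) / (Nat.factorial (x j) : ℝ) * Real.exp (-(l j * s)))) =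
      (∏ j, (l j) ^ (x j) / (Nat.factorial (x j) : ℝ)) *
        (s ^ (∑ j, x j) * Real.exp (-((∑ j, l j) * s))) := by
  rw [← Finset.prod_pow_eq_pow_sum, Finset.sum_mul, ← Finset.sum_neg_distrib, Real.exp_sum,
    ← Finset.prod_mul_distrib, ← Finset.prod_mul_distrib]
  refine Finset.prod_congr rfl fun j _ => ?_
  rw [mul_pow]; ring

theorem gcp_fpt_drift_pmf (k : ℕ) (hk : 1 ≤ k) (l : Fin k → ℝ) (hl : ∀ j, 0 < l j)
    (Λ : ℝ) (hΛ : Λ = ∑ j, l j) (μ : ℝ) (n : ℕ) (t : ℝ) (ht : 0 < t) :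
    phatDrift k l μ n t =
      ∑ x ∈ Omega k n,
        (∏ j, (l j) ^ (x j) / (Nat.factorial (x j) : ℝ)) *
          (Real.sqrt 2 * t / Real.sqrt Real.pi) * Real.exp (μ * t) *
          (t ^ 2 / (2 * Λ + μ ^ 2)) ^ ((↑(∑ j, x j) : ℝ) / 2 - 1 / 4) *
          besselK ((↑(∑ j, x j) : ℝ) - 1 / 2) (t * Real.sqrt (2 * Λ + μ ^ 2)) := by
  have hk0 : 0 < Λ := by
    rw [hΛ]
    exact Finset.sum_pos (fun j _ => hl j) ⟨⟨0, hk⟩, Finset.mem_univ _⟩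
  have hc : 0 < 2 * Λ + μ ^ 2 := by positivity
  unfold phatDrift
  have key : ∀ s ∈ Set.Ioi (0:ℝ), gcp k l n s * fptDrift μ s t =
      ∑ x ∈ Omega k n, ((∏ j, (l j) ^ (x j) / (Nat.factorial (x j) : ℝ)) *
        (t * Real.exp (μ * t) / Real.sqrt (2 * Real.pi))) *
      (s ^ (((↑(∑ j, x j) : ℝ) - 1 / 2) - 1) *
        Real.exp (-((2 * Λ + μ ^ 2) / 2 * s) - (t ^ 2 / 2) / s)) := by
    intro s hs
    unfold gcp
    rw [Finset.sum_mul]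
    refine Finset.sum_congr rfl fun x _ => ?_
    rw [aux_prod, mul_assoc, ← hΛ, aux_fpt μ s t hs]
    ring
  rw [setIntegral_congr_fun measurableSet_Ioi key, integral_finsetSum]
  · refine Finset.sum_congr rfl fun x _ => ?_
    rw [integral_const_mul, aux_subst _ _ _ (by positivity)]
    unfold besselK
    generalize hα : (↑(∑ j, x j) : ℝ) - 1 / 2 = α
    have h1 : (↑(∑ j, x j) : ℝ) / 2 - 1 / 4 = (1 / 2) * α := by rw [← hα]; ring
    rw [h1, Real.rpow_mul (by positivity), ← Real.sqrt_eq_rpow, Real.sqrt_div (by positivity),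
      Real.sqrt_sq ht.le]
    have hq : 0 < Real.sqrt (2 * Λ + μ ^ 2) := Real.sqrt_pos.2 hc
    have h2 : (t / Real.sqrt (2 * Λ + μ ^ 2)) ^ α * (t * Real.sqrt (2 * Λ + μ ^ 2) / 2) ^ α
        = (t ^ 2 / 2) ^ α := by
      rw [← Real.mul_rpow (by positivity) (by positivity)]
      congr 1; field_simp
    rw [← h2]
    have h3 : ∀ u : ℝ, (t * Real.sqrt (2 * Λ + μ ^ 2)) ^ 2 / (4 * u) =
        (2 * Λ + μ ^ 2) / 2 * (t ^ 2 / 2) / u := by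
      intro u
      rw [mul_pow, Real.sq_sqrt hc.le, mul_comm 4 u, ← div_div, div_right_comm]
      ring
    simp only [h3]
    have h4 : t * Real.exp (μ * t) / Real.sqrt (2 * Real.pi) =
        (Real.sqrt 2 * t / Real.sqrt Real.pi) * Real.exp (μ * t) * (1 / 2) := by
      rw [Real.sqrt_mul (by norm_num)]
      have h5 : Real.sqrt 2 ^ 2 = 2 := Real.sq_sqrt (by norm_num)
      field_simp
      rw [h5]
    rw [h4]; ring
  · intro x _
    apply Integrable.const_mul
    apply aux_integrable _ _ _ _ (by positivity) (by positivity)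
    have : (0:ℝ) ≤ (↑(∑ j, x j) : ℝ) := Nat.cast_nonneg _
    linarith
end
end
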